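/- Define Λ(ξ) := ξ₃/‖ξ‖ for ξ ≠ 0, write ξ_h := (ξ₁,ξ₂,0), s(ξ) := √(1−Λ(ξ)²) = ‖ξ_h‖/‖ξ‖, and for ζ with ζ_h ≠ 0 let w(ζ) := (Λ(ζ)/s(ζ))·ζ_h − ‖ζ‖·s(ζ)·e₃. Let f : ℝ³ → ℝ, let ξ, η ∈ ℝ³ with ξ_h ≠ 0 and (ξ−η)_h ≠ 0, set ζ := ξ−η and ω_c := (ξ_h·ζ_h)/(‖ξ_h‖·‖ζ_h‖), and assume f is differentiable at ζ with ζ_h^⊥·∇f(ζ) = 0 (axisymmetry at ζ, i.e. Ωf(ζ) = 0). Then w(ξ)·∇f(ζ) = (‖ξ‖/‖ζ‖)·[ ω_c·Λ(ξ)·s(ζ) − s(ξ)·Λ(ζ) ]·( ζ·∇f(ζ) ) + (‖ξ‖/‖ζ‖)·[ ω_c·Λ(ξ)·Λ(ζ) + s(ξ)·s(ζ) ]·( w(ζ)·∇f(ζ) ). -/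

import Mathlib

open MeasureTheory RealInnerProductSpace

noncomputable section

/-- Euclidean 3-space. -/
abbrev E3 : Type := EuclideanSpace ℝ (Fin 3)

/-- The vector `(a, b, c) ∈ ℝ³`. -/
def Ev3 (a b c : ℝ) : E3 := (WithLp.equiv 2 (Fin 3 → ℝ)).symm ![a, b, c]

/-- Horizontal part `v_h = (v₁, v₂, 0)` of a vector `v ∈ ℝ³`. -/
def hpart (v : E3) : E3 := Ev3 (v 0) (v 1) 0

/-- Horizontal rotation by 90 degrees: `v_h^⊥ = (−v₂, v₁, 0)`. -/
def hperp (v : E3) : E3 := Ev3 (-(v 1)) (v 0) 0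

/-- The quantity `σ̄(ξ,η) := ξ₃ η_h − η₃ ξ_h`. -/
def sigmaBar (ξ η : E3) : E3 := (ξ 2) • hpart η - (η 2) • hpart ξ

/-- The dispersion relation `Λ(ξ) = ξ₃ / ‖ξ‖`. -/
def Lam (ξ : E3) : ℝ := ξ 2 / ‖ξ‖

/-- `s(ξ) := √(1 − Λ(ξ)²)`. -/
def sfun (ξ : E3) : ℝ := Real.sqrt (1 - Lam ξ ^ 2)

/-- The vertical unit vector `e₃`. -/
def e₃ : E3 := Ev3 0 0 1

/-- The direction `w(ξ) = (Λ(ξ)/s(ξ)) ξ_h − ‖ξ‖ s(ξ) e₃` of the vector field `Υ = ∂_φ`. -/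
def wvec (ξ : E3) : E3 := (Lam ξ / sfun ξ) • hpart ξ - (‖ξ‖ * sfun ξ) • e₃

lemma real_inner_hpart (v w : E3) : ⟪hpart v, hpart w⟫ = v 0 * w 0 + v 1 * w 1 := by
  simp [hpart, Ev3, PiLp.inner_apply, Fin.sum_univ_three]
  ring

lemma norm_sq_hpart (v : E3) : ‖hpart v‖ ^ 2 = v 0 ^ 2 + v 1 ^ 2 := by
  rw [← real_inner_self_eq_norm_sq, real_inner_hpart]
  ring

lemma norm_sq_eq_hpart_add_sq (v : E3) : ‖v‖ ^ 2 = ‖hpart v‖ ^ 2 + v 2 ^ 2 := by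
  rw [norm_sq_hpart, EuclideanSpace.real_norm_sq_eq, Fin.sum_univ_three]

lemma eq_hpart_add_smul (v : E3) : v = hpart v + v 2 • e₃ := by
  ext i
  fin_cases i <;> simp [hpart, Ev3, e₃]

lemma norm_pos_of_hpart_ne_zero {v : E3} (hv : hpart v ≠ 0) : 0 < ‖v‖ := by
  have h : 0 < ‖hpart v‖ := norm_pos_iff.mpr hv
  have := norm_sq_eq_hpart_add_sq v
  refine (norm_nonneg v).lt_of_ne' fun h0 => ?_
  rw [h0] at this
  nlinarith [sq_nonneg (v 2)]

lemma sfun_eq_norm_hpart_div {v : E3} (hv : hpart v ≠ 0) : sfun v = ‖hpart v‖ / ‖v‖ := by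
  have hpos := norm_pos_of_hpart_ne_zero hv
  have h : 1 - Lam v ^ 2 = (‖hpart v‖ / ‖v‖) ^ 2 := by
    rw [Lam]
    field_simp
    linarith [norm_sq_eq_hpart_add_sq v]
  rw [sfun, h, Real.sqrt_sq (by positivity)]

lemma wvec_eq {v : E3} (hv : hpart v ≠ 0) :
    wvec v = (v 2 / ‖hpart v‖) • hpart v - ‖hpart v‖ • e₃ := by
  have hpos := norm_pos_of_hpart_ne_zero hv
  have h : 0 < ‖hpart v‖ := norm_pos_iff.mpr hv
  rw [wvec, sfun_eq_norm_hpart_div hv, Lam]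
  congr 2 <;> field_simp

/-- Expansion of `v_h` in the orthogonal frame `w_h`, `w_h^⊥`. -/
lemma norm_sq_smul_hpart (v w : E3) :
    ‖hpart w‖ ^ 2 • hpart v
      = ⟪hpart v, hpart w⟫ • hpart w + (v 1 * w 0 - v 0 * w 1) • hperp w := by
  rw [norm_sq_hpart, real_inner_hpart]
  ext i
  fin_cases i <;> simp [hpart, hperp, Ev3] <;> ring

/-- A linear functional killing `z_h^⊥` satisfies the decomposition of `w(x)` along `z`, `w(z)`. -/
lemma apply_wvec_of_apply_hperp_eq_zero (L : E3 →L[ℝ] ℝ) {x z : E3}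
    (hx : hpart x ≠ 0) (hz : hpart z ≠ 0) (hL : L (hperp z) = 0) :
    L (wvec x)
      = (‖x‖ / ‖z‖)
          * ((⟪hpart x, hpart z⟫ / (‖hpart x‖ * ‖hpart z‖)) * Lam x * sfun z - sfun x * Lam z)
          * L z
        + (‖x‖ / ‖z‖)
          * ((⟪hpart x, hpart z⟫ / (‖hpart x‖ * ‖hpart z‖)) * Lam x * Lam z + sfun x * sfun z)
          * L (wvec z) := by
  have hxn := norm_pos_of_hpart_ne_zero hx
  have hzn := norm_pos_of_hpart_ne_zero hz
  have hxh : 0 < ‖hpart x‖ := norm_pos_iff.mpr hx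
  have hzh : 0 < ‖hpart z‖ := norm_pos_iff.mpr hz
  have hLx : L (hpart x) = ⟪hpart x, hpart z⟫ / ‖hpart z‖ ^ 2 * L (hpart z) := by
    have := congrArg L (norm_sq_smul_hpart x z)
    simp only [map_add, map_smul, smul_eq_mul, hL, mul_zero, add_zero] at this
    field_simp
    rw [mul_comm, this]
  have hLz : L z = L (hpart z) + z 2 * L e₃ := by
    conv_lhs => rw [eq_hpart_add_smul z]
    simp
  rw [wvec_eq hx, wvec_eq hz, sfun_eq_norm_hpart_div hx, sfun_eq_norm_hpart_div hz, Lam, Lam, hLz]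
  simp only [map_sub, map_smul, smul_eq_mul, hLx]
  have hsq := norm_sq_eq_hpart_add_sq z
  field_simp
  rw [hsq]
  ring

/-- **`Υ_ξ = Γ_S S_{ξ−η} + Γ_Υ Υ_{ξ−η}` on axisymmetric functions (equation (6.12)).**
Writing `ζ = ξ − η` and `ω_c = (ξ_h·ζ_h)/(‖ξ_h‖‖ζ_h‖)`, if `Ωf(ζ) = 0` then
`w(ξ)·∇f(ζ) = (‖ξ‖/‖ζ‖)[ω_c Λ(ξ)s(ζ) − s(ξ)Λ(ζ)](ζ·∇f(ζ))
  + (‖ξ‖/‖ζ‖)[ω_c Λ(ξ)Λ(ζ) + s(ξ)s(ζ)](w(ζ)·∇f(ζ))`. -/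
theorem stmt_19 (f : E3 → ℝ) (ξ η : E3)
    (hξh : hpart ξ ≠ 0) (hζh : hpart (ξ - η) ≠ 0)
    (hdiff : DifferentiableAt ℝ f (ξ - η))
    (haxi : fderiv ℝ f (ξ - η) (hperp (ξ - η)) = 0) :
    fderiv ℝ f (ξ - η) (wvec ξ)
      = (‖ξ‖ / ‖ξ - η‖)
          * ((⟪hpart ξ, hpart (ξ - η)⟫ / (‖hpart ξ‖ * ‖hpart (ξ - η)‖))
              * Lam ξ * sfun (ξ - η) - sfun ξ * Lam (ξ - η))
          * fderiv ℝ f (ξ - η) (ξ - η)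
        + (‖ξ‖ / ‖ξ - η‖)
          * ((⟪hpart ξ, hpart (ξ - η)⟫ / (‖hpart ξ‖ * ‖hpart (ξ - η)‖))
              * Lam ξ * Lam (ξ - η) + sfun ξ * sfun (ξ - η))
          * fderiv ℝ f (ξ - η) (wvec (ξ - η)) := by
  exact apply_wvec_of_apply_hperp_eq_zero _ hξh hζh haxi
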